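/- (Lemma: convergence of Hurwitz convergents) Let z ∈ ℂ ∖ ℚ(i) with Hurwitz continued fraction digits a_n and convergents p_n, q_n. Then for every n ≥ 0, q_n ≠ 0 and p_n/q_n equals the finite continued fraction a_0 + 1/(a_1 + 1/(a_2 + ⋯ + 1/a_n)) ∈ ℚ(i), and p_n/q_n → z as n → ∞. -/

import Mathlib

open Complex

noncomputable section

/-- The nearest Gaussian integer to `w` (viewed in `ℂ`). -/
def nearestGaussian (w : ℂ) : ℂ :=
  (⌊w.re + 1/2⌋ : ℤ) + (⌊w.im + 1/2⌋ : ℤ) * Complex.I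

/-- The half-open fundamental square `X`. -/
def XSet : Set ℂ := {z : ℂ | z.re ∈ Set.Ico (-(1/2) : ℝ) (1/2) ∧ z.im ∈ Set.Ico (-(1/2) : ℝ) (1/2)}

/-- The field `ℚ(i)` viewed as a subset of `ℂ`. -/
def QI : Set ℂ := {z : ℂ | ∃ p q : ℚ, z = (p : ℂ) + (q : ℂ) * Complex.I}

/-- The complete quotients `z_n` of the Hurwitz algorithm. -/
def cq (z : ℂ) : ℕ → ℂ
  | 0 => z
  | n + 1 => (cq z n - nearestGaussian (cq z n))⁻¹

/-- The Hurwitz digits `a_n`. -/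
def hDigit (z : ℂ) (n : ℕ) : ℂ := nearestGaussian (cq z n)

/-- `pRec z n = (p_n, p_{n-1})`. -/
def pRec (z : ℂ) : ℕ → ℂ × ℂ
  | 0 => (hDigit z 0, 1)
  | n + 1 => (hDigit z (n + 1) * (pRec z n).1 + (pRec z n).2, (pRec z n).1)

/-- `qRec z n = (q_n, q_{n-1})`. -/
def qRec (z : ℂ) : ℕ → ℂ × ℂ
  | 0 => (1, 0)
  | n + 1 => (hDigit z (n + 1) * (qRec z n).1 + (qRec z n).2, (qRec z n).1)

/-- The numerator `p_n` of the `n`-th Hurwitz convergent. -/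
def hp (z : ℂ) (n : ℕ) : ℂ := (pRec z n).1

/-- The denominator `q_n` of the `n`-th Hurwitz convergent. -/
def hq (z : ℂ) (n : ℕ) : ℂ := (qRec z n).1

end

noncomputable section

/-- Value of the finite continued fraction `a_0 + 1/(a_1 + ⋯ + 1/a_n)`
for the list `[a_0, a_1, …, a_n]`. -/
def cfFold : List ℂ → ℂ
  | [] => 0
  | [a] => a
  | a :: b :: rest => a + (cfFold (b :: rest))⁻¹

end

lemma QI_add {u v : ℂ} (hu : u ∈ QI) (hv : v ∈ QI) : u + v ∈ QI := by
  obtain ⟨a, b, rfl⟩ := hu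
  obtain ⟨c, d, rfl⟩ := hv
  exact ⟨a + c, b + d, by push_cast; ring⟩

lemma QI_mul {u v : ℂ} (hu : u ∈ QI) (hv : v ∈ QI) : u * v ∈ QI := by
  obtain ⟨a, b, rfl⟩ := hu
  obtain ⟨c, d, rfl⟩ := hv
  refine ⟨a * c - b * d, a * d + b * c, ?_⟩
  push_cast
  linear_combination (b * d : ℂ) * Complex.I_mul_I

lemma QI_inv {u : ℂ} (hu : u ∈ QI) : u⁻¹ ∈ QI := by
  obtain ⟨a, b, rfl⟩ := hu
  refine ⟨a / (a * a + b * b), -b / (a * a + b * b), ?_⟩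
  apply Complex.ext
  · simp [Complex.inv_re, Complex.normSq_apply, ← Complex.ofReal_ratCast,
      ← Complex.ofReal_mul, ← Complex.ofReal_add, ← Complex.ofReal_div, ← Complex.ofReal_neg]
  · simp [Complex.inv_im, Complex.normSq_apply, ← Complex.ofReal_ratCast,
      ← Complex.ofReal_mul, ← Complex.ofReal_add, ← Complex.ofReal_div, ← Complex.ofReal_neg]

lemma nearestGaussian_mem_range (w : ℂ) : nearestGaussian w ∈ GaussianInt.toComplex.range :=
  ⟨⟨⌊w.re + 1/2⌋, ⌊w.im + 1/2⌋⟩, by simp [GaussianInt.toComplex_def, nearestGaussian]⟩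

lemma QI_of_mem_range {w : ℂ} (hw : w ∈ GaussianInt.toComplex.range) : w ∈ QI := by
  obtain ⟨g, rfl⟩ := hw
  exact ⟨g.re, g.im, by simp [GaussianInt.toComplex_def]⟩

lemma eq_zero_of_mem_range_of_norm_lt_one {w : ℂ} (hw : w ∈ GaussianInt.toComplex.range)
    (h : ‖w‖ < 1) : w = 0 := by
  obtain ⟨g, rfl⟩ := hw
  have h1 : Complex.normSq (GaussianInt.toComplex g) < 1 := by
    rw [Complex.normSq_eq_norm_sq]
    nlinarith [norm_nonneg (GaussianInt.toComplex g)]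
  rw [← GaussianInt.intCast_real_norm] at h1
  have h2 : g.norm < 1 := by exact_mod_cast h1
  have h3 : g = 0 := by
    rw [← GaussianInt.norm_eq_zero]
    have := GaussianInt.norm_nonneg g
    omega
  simp [h3]

lemma norm_sub_nearestGaussian_le (w : ℂ) : ‖w - nearestGaussian w‖ ≤ 3 / 4 := by
  have h : Complex.normSq (w - nearestGaussian w) ≤ 1 / 2 := by
    have h1 := Int.floor_le (w.re + 1/2)
    have h2 := Int.lt_floor_add_one (w.re + 1/2)
    have h3 := Int.floor_le (w.im + 1/2)
    have h4 := Int.lt_floor_add_one (w.im + 1/2)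
    rw [Complex.normSq_apply]
    simp only [nearestGaussian, Complex.sub_re, Complex.sub_im, Complex.add_re, Complex.add_im,
      Complex.mul_re, Complex.mul_im, Complex.intCast_re, Complex.intCast_im, Complex.I_re,
      Complex.I_im]
    nlinarith
  rw [Complex.normSq_eq_norm_sq] at h
  nlinarith [norm_nonneg (w - nearestGaussian w)]

lemma cq_not_mem_QI {z : ℂ} (hz : z ∉ QI) (n : ℕ) : cq z n ∉ QI := by
  induction n with
  | zero => exact hz
  | succ n ih =>
    intro h
    have h1 := QI_add (QI_inv h) (QI_of_mem_range (nearestGaussian_mem_range (cq z n)))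
    rw [cq, inv_inv, sub_add_cancel] at h1
    exact ih h1

lemma cq_sub_hDigit_ne_zero {z : ℂ} (hz : z ∉ QI) (n : ℕ) : cq z n - hDigit z n ≠ 0 := by
  intro h
  apply cq_not_mem_QI hz n
  rw [sub_eq_zero.mp h]
  exact QI_of_mem_range (nearestGaussian_mem_range _)

lemma pRec_mem_range (z : ℂ) (n : ℕ) :
    (pRec z n).1 ∈ GaussianInt.toComplex.range ∧ (pRec z n).2 ∈ GaussianInt.toComplex.range := by
  induction n with
  | zero => exact ⟨nearestGaussian_mem_range _, one_mem _⟩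
  | succ n ih => exact ⟨add_mem (mul_mem (nearestGaussian_mem_range _) ih.1) ih.2, ih.1⟩

lemma qRec_mem_range (z : ℂ) (n : ℕ) :
    (qRec z n).1 ∈ GaussianInt.toComplex.range ∧ (qRec z n).2 ∈ GaussianInt.toComplex.range := by
  induction n with
  | zero => exact ⟨one_mem _, zero_mem _⟩
  | succ n ih => exact ⟨add_mem (mul_mem (nearestGaussian_mem_range _) ih.1) ih.2, ih.1⟩

lemma pRec_mul_qRec_sub (z : ℂ) (n : ℕ) :
    (pRec z n).1 * (qRec z n).2 - (pRec z n).2 * (qRec z n).1 = (-1) ^ (n + 1) := by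
  induction n with
  | zero => simp [pRec, qRec]
  | succ n ih =>
    simp only [pRec, qRec]
    rw [pow_succ, ← ih]
    ring

lemma qRec_mul_sub_pRec {z : ℂ} (hz : z ∉ QI) (n : ℕ) :
    (qRec z n).1 * z - (pRec z n).1 =
      -(cq z n - hDigit z n) * ((qRec z n).2 * z - (pRec z n).2) := by
  induction n with
  | zero => simp [pRec, qRec, cq]
  | succ n ih =>
    have hx := cq_sub_hDigit_ne_zero hz n
    have h1 : cq z (n + 1) * (cq z n - hDigit z n) = 1 := inv_mul_cancel₀ hx
    simp only [pRec, qRec]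
    linear_combination cq z (n + 1) * ih - ((qRec z n).2 * z - (pRec z n).2) * h1

lemma norm_hq_mul_sub_hp_le {z : ℂ} (hz : z ∉ QI) (n : ℕ) :
    ‖hq z n * z - hp z n‖ ≤ (3 / 4) ^ (n + 1) := by
  induction n with
  | zero => simpa [hq, hp, qRec, pRec, hDigit, cq] using norm_sub_nearestGaussian_le z
  | succ n ih =>
    have h := qRec_mul_sub_pRec hz (n + 1)
    unfold hq hp at ih ⊢
    rw [h, norm_mul, norm_neg, pow_succ, mul_comm]
    exact mul_le_mul ih (norm_sub_nearestGaussian_le _) (norm_nonneg _) (by positivity)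

lemma hq_ne_zero {z : ℂ} (hz : z ∉ QI) (n : ℕ) : hq z n ≠ 0 := by
  intro h
  have h1 := norm_hq_mul_sub_hp_le hz n
  rw [h, zero_mul, zero_sub, norm_neg] at h1
  have h2 : hp z n = 0 := eq_zero_of_mem_range_of_norm_lt_one (pRec_mem_range z n).1
    (h1.trans_lt (pow_lt_one₀ (by norm_num) (by norm_num) n.succ_ne_zero))
  have h3 := pRec_mul_qRec_sub z n
  unfold hq at h
  unfold hp at h2
  rw [h, h2, zero_mul, mul_zero, sub_zero] at h3
  exact pow_ne_zero (n + 1) (neg_ne_zero.mpr one_ne_zero) h3.symm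

lemma cq_cq_one (z : ℂ) (n : ℕ) : cq (cq z 1) n = cq z (n + 1) := by
  induction n with
  | zero => rfl
  | succ n ih => rw [cq, ih, ← cq]

lemma hDigit_cq_one (z : ℂ) (n : ℕ) : hDigit (cq z 1) n = hDigit z (n + 1) := by
  rw [hDigit, cq_cq_one, hDigit]

lemma pRec_qRec_succ (z : ℂ) (n : ℕ) :
    pRec z (n + 1) = hDigit z 0 • pRec (cq z 1) n + qRec (cq z 1) n ∧
      qRec z (n + 1) = pRec (cq z 1) n := by
  induction n with
  | zero => simp [pRec, qRec, hDigit_cq_one, mul_comm]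
  | succ n ih =>
    rw [pRec, qRec.eq_2 z (n + 1), ih.1, ih.2]
    simp only [pRec, qRec, hDigit_cq_one, Prod.ext_iff, Prod.fst_add, Prod.snd_add,
      Prod.smul_fst, Prod.smul_snd, smul_eq_mul, and_true]
    ring

lemma hp_div_hq_eq_cfFold {z : ℂ} (hz : z ∉ QI) (n : ℕ) :
    hp z n / hq z n = cfFold ((List.range (n + 1)).map (hDigit z)) := by
  induction n generalizing z with
  | zero => simp [hp, hq, pRec, qRec, cfFold]
  | succ n ih =>
    have hq0 := hq_ne_zero hz (n + 1)
    have hlist : (List.range (n + 1)).map (hDigit (cq z 1)) =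
        hDigit z 1 :: (List.range n).map (fun k => hDigit z (k + 2)) := by
      simp [List.range_succ_eq_map, hDigit_cq_one, Function.comp_def]
    have hlist' : (List.range (n + 1 + 1)).map (hDigit z) =
        hDigit z 0 :: hDigit z 1 :: (List.range n).map (fun k => hDigit z (k + 2)) := by
      simp [List.range_succ_eq_map, Function.comp_def]
    have h := ih (cq_not_mem_QI hz 1)
    rw [hlist', cfFold, ← hlist, ← h, inv_div]
    have hs := pRec_qRec_succ z n
    simp only [hp, hq, hs.1, hs.2, Prod.fst_add, Prod.smul_fst, smul_eq_mul] at hq0 ⊢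
    field_simp

lemma tendsto_hp_div_hq {z : ℂ} (hz : z ∉ QI) :
    Filter.Tendsto (fun n : ℕ => hp z n / hq z n) Filter.atTop (nhds z) := by
  rw [tendsto_iff_norm_sub_tendsto_zero]
  have hlim : Filter.Tendsto (fun n : ℕ => ((3 : ℝ) / 4) ^ (n + 1)) Filter.atTop (nhds 0) :=
    (tendsto_pow_atTop_nhds_zero_of_lt_one (by norm_num) (by norm_num)).comp
      (Filter.tendsto_add_atTop_nat 1)
  refine squeeze_zero (fun _ => norm_nonneg _) (fun n => ?_) hlim
  have hq0 := hq_ne_zero hz n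
  have h1 : 1 ≤ ‖hq z n‖ := by
    by_contra! h
    exact hq0 (eq_zero_of_mem_range_of_norm_lt_one (qRec_mem_range z n).1 h)
  have h2 : hp z n / hq z n - z = -(hq z n * z - hp z n) / hq z n := by
    field_simp
    ring
  rw [h2, norm_div, norm_neg]
  exact (div_le_self (norm_nonneg _) h1).trans (norm_hq_mul_sub_hp_le hz n)

/-- Convergence of Hurwitz convergents. -/
theorem hurwitz_convergents (z : ℂ) (hz : z ∉ QI) :
    (∀ n : ℕ, hq z n ≠ 0 ∧
      hp z n / hq z n = cfFold ((List.range (n + 1)).map (hDigit z)) ∧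
      hp z n / hq z n ∈ QI) ∧
    Filter.Tendsto (fun n : ℕ => hp z n / hq z n) Filter.atTop (nhds z) := by
  refine ⟨fun n => ⟨hq_ne_zero hz n, hp_div_hq_eq_cfFold hz n, ?_⟩, tendsto_hp_div_hq hz⟩
  rw [div_eq_mul_inv]
  exact QI_mul (QI_of_mem_range (pRec_mem_range z n).1)
    (QI_inv (QI_of_mem_range (qRec_mem_range z n).1))
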